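/- Let G be a simple graph on vertices v_1, …, v_n with degree sequence (d_1, …, d_n). Then the permanent of the Laplacian matrix of G satisfies per(L(G)) = Σ_{K ⊆ {1,…,n}} Σ_{H ∈ H(K)} (−1)^{|K|} 2^{c(H)} Π_{i ∉ K} d_i, where for each subset K, H(K) denotes the set of all subgraphs H of G whose vertex set is exactly {v_i : i ∈ K} and each of whose connected components is either a single edge or a cycle, and c(H) is the number of components of H that are cycles. -/

import Mathlib

open scoped Classical
open Polynomial

noncomputable section

instance fintypeSubgraph {V : Type*} [Fintype V] (G : SimpleGraph V) :
    Fintype G.Subgraph := by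
  have hinj : Function.Injective (fun H : G.Subgraph => (H.verts, H.Adj)) := by
    intro H₁ H₂ h
    simp only [Prod.mk.injEq] at h
    exact SimpleGraph.Subgraph.ext h.1 h.2
  have : Finite G.Subgraph := Finite.of_injective _ hinj
  exact Fintype.ofFinite _

/-- `H` is a subgraph of `G` each of whose connected components is a single edge or a
cycle; equivalently, every vertex of `H` has degree `1` or `2` in `H` and any two adjacent
vertices of `H` have equal degrees (which rules out isolated vertices and paths on three
or more vertices). -/
def IsEdgeCycleSubgraph {V : Type*} [Fintype V] {G : SimpleGraph V}
    (H : G.Subgraph) : Prop :=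
  (∀ v ∈ H.verts, H.degree v = 1 ∨ H.degree v = 2) ∧
  (∀ v w : V, H.Adj v w → H.degree v = H.degree w)

/-- The number of connected components of `H` that are cycles: since the cycle components
of such an `H` are exactly the components all of whose vertices have degree `2`, this is
the number of connected components of the subgraph of `H` induced on its vertices of
degree `2`. -/
def numCycles {V : Type*} [Fintype V] {G : SimpleGraph V} (H : G.Subgraph) : ℕ :=
  Fintype.card (SimpleGraph.ConnectedComponent
    (SimpleGraph.induce {v : V | H.degree v = 2} H.spanningCoe))

namespace EC

section TwoReg

variable {W : Type*} (Γ : SimpleGraph W) (o : W → W → W)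

structure IsOther : Prop where
  adj : ∀ v u, Γ.Adj v u → Γ.Adj v (o v u)
  ne : ∀ v u, Γ.Adj v u → o v u ≠ u
  eq : ∀ v u x, Γ.Adj v u → Γ.Adj v x → x = u ∨ x = o v u

variable {Γ o}

theorem IsOther.invol (h : IsOther Γ o) {v u : W} (hu : Γ.Adj v u) : o v (o v u) = u := by
  rcases h.eq v (o v u) u (h.adj v u hu) hu with h1 | h1
  · exact absurd h1.symm (h.ne v u hu)
  · exact h1.symm

def stepFun (h : IsOther Γ o) (d : Γ.Dart) : Γ.Dart :=
  ⟨(d.snd, o d.snd d.fst), h.adj _ _ d.adj.symm⟩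

theorem step_symm (h : IsOther Γ o) (d : Γ.Dart) :
    (stepFun h (stepFun h d).symm).symm = d := by
  ext
  · exact h.invol d.adj.symm
  · rfl

def step (h : IsOther Γ o) : Equiv.Perm Γ.Dart where
  toFun := stepFun h
  invFun d := (stepFun h d.symm).symm
  left_inv d := step_symm h d
  right_inv d := by
    have := step_symm h d.symm
    apply_fun SimpleGraph.Dart.symm at this
    simpa using this

def rev (Γ : SimpleGraph W) : Equiv.Perm Γ.Dart :=
  Function.Involutive.toPerm SimpleGraph.Dart.symm SimpleGraph.Dart.symm_involutive

theorem rev_conj (h : IsOther Γ o) (n : ℤ) (d : Γ.Dart) :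
    ((step h ^ n) d).symm = (step h ^ (-n)) d.symm := by
  have h1 : rev Γ * step h * (rev Γ)⁻¹ = (step h)⁻¹ := by
    ext1 d
    rfl
  have h2 : rev Γ * step h ^ n * (rev Γ)⁻¹ = step h ^ (-n) := by
    rw [← conj_zpow, h1, inv_zpow, zpow_neg]
  have h3 := congrArg (fun p : Equiv.Perm Γ.Dart => p d.symm) h2
  simp only [Equiv.Perm.mul_apply] at h3
  rw [← h3]
  have : (rev Γ)⁻¹ d.symm = d := by
    rw [Equiv.Perm.inv_eq_iff_eq]; rfl
  rw [this]; rfl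

theorem not_sameCycle_symm (h : IsOther Γ o) (d : Γ.Dart) :
    ¬ (step h).SameCycle d d.symm := by
  rintro ⟨k, hk⟩
  rcases Int.even_or_odd' k with ⟨m, rfl | rfl⟩
  · have := rev_conj h m d
    rw [← hk, ← Equiv.Perm.mul_apply, ← zpow_add, show -m + 2 * m = m by ring] at this
    exact SimpleGraph.Dart.symm_ne _ this
  · have := rev_conj h m d
    rw [← hk, ← Equiv.Perm.mul_apply, ← zpow_add, show -m + (2 * m + 1) = 1 + m by ring,
      zpow_add, Equiv.Perm.mul_apply, zpow_one] at this
    generalize (step h ^ m) d = e at this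
    have h3 := congrArg (fun d : Γ.Dart => d.snd) this
    exact h.ne _ _ e.adj.symm h3.symm

def Ori (Γ : SimpleGraph W) (σ : Equiv.Perm W) : Prop :=
  ∀ v w, Γ.Adj v w ↔ (σ v = w ∨ σ w = v)

theorem exists_ori [Finite W] (h : IsOther Γ o) (b : Γ.ConnectedComponent → Γ.Dart)
    (hb : ∀ c, Γ.connectedComponentMk (b c).fst = c) :
    ∃ σ : Equiv.Perm W, Ori Γ σ ∧ ∀ c, σ (b c).fst = (b c).snd := by
  let P : Γ.Dart → Prop := fun d =>
    (step h).SameCycle (b (Γ.connectedComponentMk d.fst)) d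
  have hc : ∀ d : Γ.Dart, Γ.connectedComponentMk d.snd = Γ.connectedComponentMk d.fst :=
    fun d => SimpleGraph.ConnectedComponent.sound d.adj.symm.reachable
  have P1 : ∀ d, P (step h d) ↔ P d := by
    intro d
    have : (step h d).fst = d.snd := rfl
    simp only [P, this, hc, Equiv.Perm.sameCycle_apply_right]
  have P2 : ∀ d, P d → ¬ P d.symm := by
    intro d h1 h2
    have : d.symm.fst = d.snd := rfl
    simp only [P, this, hc] at h1 h2
    exact not_sameCycle_symm h d (h1.symm.trans h2)
  have Pb : ∀ c, P (b c) := by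
    intro c
    simp only [P, hb]
    exact Equiv.Perm.SameCycle.refl _ _
  have P3 : ∀ v, ∃ d : Γ.Dart, d.fst = v ∧ P d := by
    intro v
    have hr : Γ.Reachable (b (Γ.connectedComponentMk v)).fst v :=
      SimpleGraph.ConnectedComponent.exact (hb _)
    rw [SimpleGraph.reachable_iff_reflTransGen] at hr
    have hbase := Pb (Γ.connectedComponentMk v)
    generalize b (Γ.connectedComponentMk v) = d0 at hr hbase
    induction hr with
    | refl => exact ⟨_, rfl, hbase⟩
    | tail _ hxy ih =>
      rename_i x y _
      obtain ⟨d, rfl, hd⟩ := ih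
      rcases h.eq _ _ _ d.adj hxy with rfl | hy
      · exact ⟨step h d, rfl, (P1 _).2 hd⟩
      · refine ⟨(step h)⁻¹ d, hy.symm, ?_⟩
        rw [← P1]; simpa using hd
  have P4 : ∀ d e : Γ.Dart, P d → P e → d.fst = e.fst → d = e := by
    intro d e hd he hde
    by_contra hne
    have hs : e.snd = o d.fst d.snd := by
      rcases h.eq d.fst d.snd e.snd d.adj (hde ▸ e.adj) with h1 | h1
      · exact absurd (SimpleGraph.Dart.ext _ _ (Prod.ext hde h1.symm)) hne
      · exact h1
    have : e = step h d.symm :=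
      SimpleGraph.Dart.ext _ _ (Prod.ext hde.symm hs)
    rw [this, P1] at he
    exact P2 d hd he
  choose s hs1 hs2 using P3
  have hinj : Function.Injective (fun v => (s v).snd) := by
    intro v w hvw
    have := P4 (step h (s v)) (step h (s w)) ((P1 _).2 (hs2 v)) ((P1 _).2 (hs2 w)) hvw
    rw [← hs1 v, ← hs1 w, (step h).injective this]
  refine ⟨Equiv.ofBijective _ (Finite.injective_iff_bijective.1 hinj), ?_, ?_⟩
  · intro v w
    simp only [Equiv.ofBijective_apply]
    have key : ∀ v, Γ.Adj v (s v).snd := fun v => by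
      have := (s v).adj
      rwa [hs1] at this
    constructor
    · intro hvw
      rcases h.eq v _ w (key v) hvw with h1 | h1
      · exact Or.inl h1.symm
      · right
        let d : Γ.Dart := ⟨(v, w), hvw⟩
        have hd : d = step h (s v).symm := by
          refine SimpleGraph.Dart.ext _ _ (Prod.ext (hs1 v).symm ?_)
          change w = o (s v).fst (s v).snd
          rw [hs1, h1]
        have hd2 : P d.symm := by
          rw [← P1]
          have : step h d.symm = s v := by
            rw [hd]
            have := step_symm h (s v).symm
            apply_fun SimpleGraph.Dart.symm at this
            rw [SimpleGraph.Dart.symm_symm, SimpleGraph.Dart.symm_symm] at this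
            exact this
          rw [this]; exact hs2 v
        have := P4 (s w) d.symm (hs2 w) hd2 (hs1 w)
        rw [this]; rfl
    · rintro (rfl | rfl)
      · exact key v
      · exact (key w).symm
  · intro c
    change (s (b c).fst).snd = _
    rw [P4 (s (b c).fst) (b c) (hs2 _) (Pb c) (hs1 _)]

theorem ori_step (h : IsOther Γ o) {σ τ : Equiv.Perm W} (hσ : Ori Γ σ) (hτ : Ori Γ τ)
    {v w : W} (hv : σ v = τ v) (hvw : Γ.Adj v w) : σ w = τ w := by
  have nxt : ∀ (σ : Equiv.Perm W), Ori Γ σ → ∀ v, σ (σ v) = o (σ v) v := by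
    intro σ hσ v
    have a1 : Γ.Adj (σ v) v := (hσ _ _).2 (Or.inr rfl)
    have a2 : Γ.Adj (σ v) (σ (σ v)) := (hσ _ _).2 (Or.inl rfl)
    obtain h1 | h1 := h.eq _ _ _ a1 a2
    · exfalso
      have h3 := (hσ (σ v) (o (σ v) v)).1 (h.adj _ _ a1)
      rcases h3 with h3 | h3
      · exact h.ne _ _ a1 (h3.symm.trans h1)
      · exact h.ne _ _ a1 (σ.injective h3)
    · exact h1
  rcases (hσ v w).1 hvw with h1 | h1
  · have h2 : τ v = w := hv ▸ h1
    have e1 := nxt σ hσ v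
    have e2 := nxt τ hτ v
    rw [h1] at e1; rw [h2] at e2; rw [e1, e2]
  · rcases (hτ v w).1 hvw with h2 | h2
    · exfalso
      have e1 := nxt σ hσ w
      rw [h1, hv, h2] at e1
      exact h.ne _ _ hvw e1.symm
    · rw [h1, h2]

theorem card_ori [Fintype W] (h : IsOther Γ o) (hne : ∀ v, ∃ w, Γ.Adj v w) :
    Nat.card {σ : Equiv.Perm W // Ori Γ σ} = 2 ^ Nat.card Γ.ConnectedComponent := by
  have hb : ∀ c : Γ.ConnectedComponent, ∃ d : Γ.Dart, Γ.connectedComponentMk d.fst = c := by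
    intro c
    induction c using SimpleGraph.ConnectedComponent.ind with
    | h v =>
      obtain ⟨w, hw⟩ := hne v
      exact ⟨⟨(v, w), hw⟩, rfl⟩
  choose b hb using hb
  let F : {σ : Equiv.Perm W // Ori Γ σ} → (Γ.ConnectedComponent → Bool) :=
    fun σ c => decide (σ.1 (b c).fst = (b c).snd)
  have hF : Function.Bijective F := by
    constructor
    · rintro ⟨σ, hσ⟩ ⟨τ, hτ⟩ hst
      ext v
      change σ v = τ v
      have base : σ (b (Γ.connectedComponentMk v)).fst = τ (b (Γ.connectedComponentMk v)).fst := by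
        have h1 := congrFun hst (Γ.connectedComponentMk v)
        simp only [F, decide_eq_decide] at h1
        generalize b (Γ.connectedComponentMk v) = d at h1
        by_cases h2 : σ d.fst = d.snd
        · rw [h2, h1.1 h2]
        · have a1 := (h.eq _ _ (σ d.fst) d.adj ((hσ _ _).2 (Or.inl rfl))).resolve_left h2
          have a2 := (h.eq _ _ (τ d.fst) d.adj ((hτ _ _).2 (Or.inl rfl))).resolve_left
            (fun h3 => h2 (h1.2 h3))
          rw [a1, a2]
      have hr : Γ.Reachable (b (Γ.connectedComponentMk v)).fst v :=
        SimpleGraph.ConnectedComponent.exact (hb _)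
      rw [SimpleGraph.reachable_iff_reflTransGen] at hr
      generalize b (Γ.connectedComponentMk v) = d0 at hr base
      induction hr with
      | refl => exact base
      | tail _ hxy ih => exact ori_step h hσ hτ ih hxy
    · intro β
      obtain ⟨σ, hσ, hs⟩ := exists_ori h (fun c => if β c then b c else (b c).symm) (by
        intro c
        split_ifs
        · exact hb c
        · refine Eq.trans ?_ (hb c)
          exact SimpleGraph.ConnectedComponent.sound (b c).adj.symm.reachable)
      refine ⟨⟨σ, hσ⟩, ?_⟩
      funext c
      have h1 := hs c
      simp only [F]
      cases hβ : β c
      · simp only [hβ, Bool.false_eq_true, if_false] at h1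
        replace h1 : σ (b c).snd = (b c).fst := h1
        rw [decide_eq_false_iff_not]
        intro h2
        generalize b c = d at h1 h2
        have h3 := (hσ d.fst (o d.fst d.snd)).1 (h.adj _ _ d.adj)
        rcases h3 with h3 | h3
        · exact h.ne _ _ d.adj (h3.symm.trans h2)
        · exact h.ne _ _ d.adj (σ.injective (h3.trans h1.symm))
      · simp only [hβ, if_true] at h1
        simpa using h1
  rw [Nat.card_congr (Equiv.ofBijective F hF)]
  simp [Nat.card_fun]

end TwoReg

end EC

namespace EC

variable {V : Type*} [Fintype V] {G : SimpleGraph V}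

def ofPerm (G : SimpleGraph V) (σ : Equiv.Perm V) : G.Subgraph where
  verts := {v | σ v ≠ v}
  Adj v w := G.Adj v w ∧ (σ v = w ∨ σ w = v)
  adj_sub h := h.1
  edge_vert := by
    rintro v w ⟨h, rfl | h1⟩
    · exact h.ne'
    · intro h2
      exact h.ne (σ.injective (h2.trans h1.symm))
  symm := ⟨fun _ _ h => ⟨h.1.symm, h.2.symm⟩⟩

def Good (G : SimpleGraph V) (σ : Equiv.Perm V) : Prop := ∀ v, σ v ≠ v → G.Adj (σ v) v

theorem degree_eq (H : G.Subgraph) (v : V) :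
    H.degree v = (Finset.univ.filter (fun w => H.Adj v w)).card := by
  rw [← SimpleGraph.Subgraph.finset_card_neighborSet_eq_degree]
  congr 1
  ext w
  simp

theorem ofPerm_degree {σ : Equiv.Perm V} (hg : Good G σ) {v : V} (hv : σ v ≠ v) :
    (ofPerm G σ).degree v = if σ (σ v) = v then 1 else 2 := by
  have h1 : Finset.univ.filter (fun w => (ofPerm G σ).Adj v w) = {σ v, σ⁻¹ v} := by
    ext w
    simp only [Finset.mem_filter, Finset.mem_univ, true_and, Finset.mem_insert,
      Finset.mem_singleton, Equiv.Perm.eq_inv_iff_eq]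
    constructor
    · rintro ⟨_, h | h⟩
      · exact Or.inl h.symm
      · exact Or.inr h
    · rintro (rfl | rfl)
      · exact ⟨(hg v hv).symm, Or.inl rfl⟩
      · exact ⟨hg w (fun h => hv (by rw [h, h])), Or.inr rfl⟩
  rw [degree_eq, h1]
  split_ifs with h
  · have : σ v = σ⁻¹ v := by rw [Equiv.Perm.eq_inv_iff_eq]; exact h
    rw [this]; simp
  · apply Finset.card_pair
    rw [Ne, Equiv.Perm.eq_inv_iff_eq]; exact h

theorem ofPerm_ec {σ : Equiv.Perm V} (hg : Good G σ) : IsEdgeCycleSubgraph (ofPerm G σ) := by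
  constructor
  · intro v hv
    rw [ofPerm_degree hg hv]
    split_ifs <;> simp
  · have key : ∀ v, σ v ≠ v → (ofPerm G σ).degree v = (ofPerm G σ).degree (σ v) := by
      intro v hv
      rw [ofPerm_degree hg hv, ofPerm_degree hg (fun h => hv (σ.injective h))]
      simp only [EmbeddingLike.apply_eq_iff_eq]
    rintro v w ⟨h, rfl | rfl⟩
    · exact key v h.ne'
    · exact (key w h.ne).symm

theorem nonverts_degree (H : G.Subgraph) {v : V} (hv : v ∉ H.verts) : H.degree v = 0 := by
  rw [degree_eq, Finset.card_eq_zero, Finset.filter_eq_empty_iff]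
  intro w _ h
  exact hv (H.edge_vert h)

theorem degree_one {H : G.Subgraph} {v : V} (h : H.degree v = 1) :
    ∃ a, ∀ w, H.Adj v w ↔ w = a := by
  rw [degree_eq, Finset.card_eq_one] at h
  obtain ⟨a, ha⟩ := h
  refine ⟨a, fun w => ?_⟩
  have := congrArg (fun s => w ∈ s) ha
  simpa using this

theorem degree_two {H : G.Subgraph} {v : V} (h : H.degree v = 2) :
    ∃ a b, a ≠ b ∧ ∀ w, H.Adj v w ↔ w = a ∨ w = b := by
  rw [degree_eq, Finset.card_eq_two] at h
  obtain ⟨a, b, hab, ha⟩ := h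
  refine ⟨a, b, hab, fun w => ?_⟩
  have := congrArg (fun s => w ∈ s) ha
  simpa using this

theorem fiber_iff (H : G.Subgraph) (σ : Equiv.Perm V) :
    (Good G σ ∧ ofPerm G σ = H) ↔
      ((∀ v w, H.Adj v w ↔ v ≠ w ∧ (σ v = w ∨ σ w = v)) ∧ ∀ v, v ∈ H.verts ↔ σ v ≠ v) := by
  constructor
  · rintro ⟨hg, rfl⟩
    refine ⟨fun v w => ⟨fun h => ⟨h.1.ne, h.2⟩, ?_⟩, fun v => Iff.rfl⟩
    rintro ⟨hne, h⟩
    refine ⟨?_, h⟩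
    rcases h with rfl | rfl
    · exact (hg v hne.symm).symm
    · exact hg w hne
  · rintro ⟨h1, h2⟩
    have hg : Good G σ := fun v hv => (((h1 v (σ v)).2 ⟨hv.symm, Or.inl rfl⟩).adj_sub).symm
    refine ⟨hg, ?_⟩
    ext v w
    · exact (h2 v).symm
    · rw [h1]
      constructor
      · exact fun h => ⟨h.1.ne, h.2⟩
      · intro h
        exact ⟨((h1 v w).2 h).adj_sub, h.2⟩

theorem fiber_card {H : G.Subgraph} (hH : IsEdgeCycleSubgraph H) :
    Nat.card {σ : Equiv.Perm V //
      (∀ v w, H.Adj v w ↔ v ≠ w ∧ (σ v = w ∨ σ w = v)) ∧ ∀ v, v ∈ H.verts ↔ σ v ≠ v} =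
      2 ^ numCycles H := by
  let S : Set V := {v : V | H.degree v = 2}
  let Γ : SimpleGraph S := SimpleGraph.induce S H.spanningCoe
  have hΓ : ∀ v w : S, Γ.Adj v w ↔ H.Adj v w := fun v w => Iff.rfl
  have hSadj : ∀ v w, H.Adj v w → v ∈ S → w ∈ S := fun v w h hv => by
    change H.degree w = 2
    rw [← hH.2 v w h]; exact hv
  have hSv : ∀ v ∈ S, v ∈ H.verts := by
    intro v hv
    by_contra h
    have h1 : H.degree v = 2 := hv
    rw [nonverts_degree H h] at h1
    omega
  have ho : ∀ v u : S, ∃ x : S, Γ.Adj v u →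
      (Γ.Adj v x ∧ x ≠ u ∧ ∀ y, Γ.Adj v y → y = u ∨ y = x) := by
    intro v u
    by_cases huv : Γ.Adj v u
    · obtain ⟨a, b, hab, hw⟩ := degree_two v.2
      have ha : H.Adj v a := (hw a).2 (Or.inl rfl)
      have hb : H.Adj v b := (hw b).2 (Or.inr rfl)
      rcases (hw u).1 huv with h | h
      · refine ⟨⟨b, hSadj _ _ hb v.2⟩, fun _ => ⟨hb, ?_, ?_⟩⟩
        · intro h1
          exact hab (h.symm.trans (congrArg Subtype.val h1).symm)
        · intro y hy
          rcases (hw y).1 hy with h2 | h2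
          · exact Or.inl (Subtype.ext (h2.trans h.symm))
          · exact Or.inr (Subtype.ext h2)
      · refine ⟨⟨a, hSadj _ _ ha v.2⟩, fun _ => ⟨ha, ?_, ?_⟩⟩
        · intro h1
          exact hab ((congrArg Subtype.val h1).trans h)
        · intro y hy
          rcases (hw y).1 hy with h2 | h2
          · exact Or.inr (Subtype.ext h2)
          · exact Or.inl (Subtype.ext (h2.trans h.symm))
    · exact ⟨u, fun h => absurd h huv⟩
  choose o ho using ho
  have hoth : IsOther Γ o :=
    ⟨fun v u h => (ho v u h).1, fun v u h => (ho v u h).2.1,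
      fun v u x h hx => (ho v u h).2.2 x hx⟩
  have hne : ∀ v : S, ∃ w, Γ.Adj v w := by
    intro v
    obtain ⟨a, b, hab, hw⟩ := degree_two v.2
    have ha : H.Adj v a := (hw a).2 (Or.inl rfl)
    exact ⟨⟨a, hSadj _ _ ha v.2⟩, ha⟩
  have hcard := card_ori hoth hne
  have hnum : numCycles H = Nat.card Γ.ConnectedComponent := by
    unfold numCycles
    rw [Nat.card_eq_fintype_card]
  rw [hnum, ← hcard]
  have hpres : ∀ σ : Equiv.Perm V,
      ((∀ v w, H.Adj v w ↔ v ≠ w ∧ (σ v = w ∨ σ w = v)) ∧ ∀ v, v ∈ H.verts ↔ σ v ≠ v) →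
      ∀ v, σ v ∈ S ↔ v ∈ S := by
    rintro σ ⟨h1, h2⟩ v
    by_cases hv : σ v = v
    · rw [hv]
    · have ha : H.Adj v (σ v) := (h1 _ _).2 ⟨fun h => hv h.symm, Or.inl rfl⟩
      exact ⟨hSadj _ _ ha.symm, hSadj _ _ ha⟩
  let Ψ : {σ : Equiv.Perm V //
      (∀ v w, H.Adj v w ↔ v ≠ w ∧ (σ v = w ∨ σ w = v)) ∧ ∀ v, v ∈ H.verts ↔ σ v ≠ v} →
      {σ : Equiv.Perm S // Ori Γ σ} := fun σ =>
    ⟨σ.1.subtypePerm (hpres σ.1 σ.2), by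
      intro v w
      rw [hΓ, σ.2.1]
      have hv : σ.1 v ≠ v := (σ.2.2 v).1 (hSv _ v.2)
      have hw : σ.1 w ≠ w := (σ.2.2 w).1 (hSv _ w.2)
      simp only [Subtype.ext_iff, Equiv.Perm.subtypePerm_apply]
      constructor
      · exact fun h => h.2
      · intro h
        refine ⟨?_, h⟩
        intro he
        rw [he] at h
        exact hw (h.elim id id)⟩
  refine Nat.card_congr (Equiv.ofBijective Ψ ⟨?_, ?_⟩)
  · rintro ⟨σ, hσ1, hσ2⟩ ⟨τ, hτ1, hτ2⟩ heq
    ext v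
    change σ v = τ v
    by_cases hv : v ∈ H.verts
    · rcases hH.1 v hv with h | h
      · obtain ⟨a, ha⟩ := degree_one h
        rw [(ha (σ v)).1 ((hσ1 _ _).2 ⟨((hσ2 v).1 hv).symm, Or.inl rfl⟩),
          (ha (τ v)).1 ((hτ1 _ _).2 ⟨((hτ2 v).1 hv).symm, Or.inl rfl⟩)]
      · have h1 := congrArg (fun p => ((p.1 ⟨v, h⟩ : S) : V)) heq
        exact h1
    · rw [not_not.1 (fun h => hv ((hσ2 v).2 h)), not_not.1 (fun h => hv ((hτ2 v).2 h))]
  · rintro ⟨ρ, hρ⟩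
    have ht : ∀ v, ∃ a, (H.degree v = 1 → ∀ w, H.Adj v w ↔ w = a) ∧
        (H.degree v ≠ 1 → a = v) := by
      intro v
      by_cases h : H.degree v = 1
      · obtain ⟨a, ha⟩ := degree_one h
        exact ⟨a, fun _ => ha, fun h' => absurd h h'⟩
      · exact ⟨v, fun h' => absurd h' h, fun _ => rfl⟩
    choose t ht1 ht2 using ht
    have htadj : ∀ v, H.degree v = 1 → H.Adj v (t v) := fun v h => (ht1 v h _).2 rfl
    have htdeg : ∀ v, H.degree (t v) = H.degree v := by
      intro v
      by_cases h : H.degree v = 1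
      · exact (hH.2 _ _ (htadj v h)).symm
      · rw [ht2 v h]
    have htinv : Function.Involutive t := by
      intro v
      by_cases h : H.degree v = 1
      · exact ((ht1 (t v) ((htdeg v).trans h) v).1 (htadj v h).symm).symm
      · rw [ht2 v h, ht2 v h]
    let σ : Equiv.Perm V := Equiv.Perm.ofSubtype ρ * htinv.toPerm
    have hσ : ∀ v, σ v = Equiv.Perm.ofSubtype ρ (t v) := fun v => rfl
    have e2 : ∀ v : S, σ v = ρ v := by
      intro v
      have hv : H.degree v = 2 := v.2
      rw [hσ, ht2 v (by omega), Equiv.Perm.ofSubtype_apply_coe]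
    have e1 : ∀ v, v ∉ S → σ v = t v := by
      intro v hv
      rw [hσ, Equiv.Perm.ofSubtype_apply_of_not_mem]
      intro h
      apply hv
      change H.degree v = 2
      rw [← htdeg]; exact h
    have K1 : ∀ v ∈ H.verts, H.Adj v (σ v) := by
      intro v hv
      rcases hH.1 v hv with h | h
      · rw [e1 v (by change ¬ (H.degree v = 2); omega)]
        exact htadj v h
      · have := (hρ ⟨v, h⟩ (ρ ⟨v, h⟩)).2 (Or.inl rfl)
        rw [hΓ, ← e2] at this
        exact this
    have K2 : ∀ v, v ∉ H.verts → σ v = v := by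
      intro v hv
      have h0 := nonverts_degree H hv
      rw [e1 v (by change ¬ (H.degree v = 2); omega), ht2 v (by omega)]
    have K3 : ∀ v, v ∈ H.verts ↔ σ v ≠ v := fun v =>
      ⟨fun h => ((K1 v h).adj_sub).ne', fun h => by
        by_contra h'
        exact h (K2 v h')⟩
    have K4 : ∀ v w, H.Adj v w ↔ v ≠ w ∧ (σ v = w ∨ σ w = v) := by
      intro v w
      constructor
      · intro h
        refine ⟨h.adj_sub.ne, ?_⟩
        rcases hH.1 v (H.edge_vert h) with h1 | h1
        · left
          rw [e1 v (by change ¬ (H.degree v = 2); omega)]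
          exact ((ht1 v h1 w).1 h).symm
        · have h2 : w ∈ S := hSadj _ _ h h1
          have h3 := (hρ ⟨v, h1⟩ ⟨w, h2⟩).1 h
          rw [Subtype.ext_iff, Subtype.ext_iff, ← e2, ← e2] at h3
          exact h3
      · rintro ⟨hne', rfl | rfl⟩
        · exact K1 v ((K3 v).2 hne'.symm)
        · exact (K1 w ((K3 w).2 hne')).symm
    refine ⟨⟨σ, K4, K3⟩, ?_⟩
    ext v
    exact e2 v

theorem prod_good {σ : Equiv.Perm V} (hg : Good G σ) :
    ∏ v, G.lapMatrix ℤ (σ v) v = (-1 : ℤ) ^ ((ofPerm G σ).verts.ncard) *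
      ∏ v ∈ Finset.univ.filter (fun v => v ∉ (ofPerm G σ).verts), (G.degree v : ℤ) := by
  rw [← Finset.prod_filter_mul_prod_filter_not Finset.univ (fun v => v ∈ (ofPerm G σ).verts)]
  congr 1
  · rw [Finset.prod_congr rfl (g := fun _ => (-1 : ℤ)), Finset.prod_const]
    · congr 1
      rw [Set.ncard_eq_toFinset_card']
      congr 1
      ext v
      simp
    · intro v hv
      have hv' : σ v ≠ v := (Finset.mem_filter.1 hv).2
      simp [SimpleGraph.lapMatrix, SimpleGraph.degMatrix, Matrix.diagonal_apply_ne _ hv',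
        hg v hv']
  · refine Finset.prod_congr rfl fun v hv => ?_
    have hv' : σ v = v := not_not.1 (Finset.mem_filter.1 hv).2
    rw [hv']
    simp [SimpleGraph.lapMatrix, SimpleGraph.degMatrix]

theorem prod_not_good {σ : Equiv.Perm V} (hg : ¬ Good G σ) :
    ∏ v, G.lapMatrix ℤ (σ v) v = 0 := by
  unfold Good at hg
  push Not at hg
  obtain ⟨v, hv, h⟩ := hg
  refine Finset.prod_eq_zero (Finset.mem_univ v) ?_
  simp [SimpleGraph.lapMatrix, SimpleGraph.degMatrix, Matrix.diagonal_apply_ne _ hv, h]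

end EC

/-- **Brualdi–Goldwasser (Lemma 2.11).** The permanent of the Laplacian matrix of `G`
equals `∑_K ∑_{H ∈ H(K)} (−1)^{|K|} 2^{c(H)} ∏_{i ∉ K} dᵢ`, where `H(K)` runs over the
subgraphs of `G` with vertex set `K` each of whose components is an edge or a cycle, and
`c(H)` is the number of cycle components of `H`. (Here the double sum is written as a
single sum over all such subgraphs `H`, the set `K` being `H.verts`.) -/
theorem permanent_lapMatrix_eq_sum_edgeCycleSubgraphs
    {V : Type*} [Fintype V] (G : SimpleGraph V) :
    Matrix.permanent (G.lapMatrix ℤ) =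
      ∑ H ∈ Finset.univ.filter (fun H : G.Subgraph => IsEdgeCycleSubgraph H),
        (-1 : ℤ) ^ (H.verts.ncard) * 2 ^ (numCycles H) *
          ∏ v ∈ Finset.univ.filter (fun v => v ∉ H.verts), (G.degree v : ℤ) := by
  unfold Matrix.permanent
  rw [← Finset.sum_filter_add_sum_filter_not Finset.univ (fun σ => EC.Good G σ),
    Finset.sum_eq_zero (s := Finset.univ.filter (fun σ => ¬ EC.Good G σ))
      (fun σ hσ => EC.prod_not_good (Finset.mem_filter.1 hσ).2), add_zero,
    ← Finset.sum_fiberwise_of_maps_to (g := EC.ofPerm G)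
      (t := Finset.univ.filter (fun H : G.Subgraph => IsEdgeCycleSubgraph H))
      (fun σ hσ => Finset.mem_filter.2
        ⟨Finset.mem_univ _, EC.ofPerm_ec (Finset.mem_filter.1 hσ).2⟩)]
  refine Finset.sum_congr rfl fun H hH => ?_
  have hEC : IsEdgeCycleSubgraph H := (Finset.mem_filter.1 hH).2
  have hconst : ∀ σ ∈ (Finset.univ.filter (fun σ => EC.Good G σ)).filter
      (fun σ => EC.ofPerm G σ = H), ∏ v, G.lapMatrix ℤ (σ v) v =
        (-1 : ℤ) ^ (H.verts.ncard) *
          ∏ v ∈ Finset.univ.filter (fun v => v ∉ H.verts), (G.degree v : ℤ) := by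
    intro σ hσ
    simp only [Finset.mem_filter, Finset.mem_univ, true_and] at hσ
    obtain ⟨hg, rfl⟩ := hσ
    exact EC.prod_good hg
  rw [Finset.sum_congr rfl hconst, Finset.sum_const, Finset.filter_filter]
  simp only [EC.fiber_iff]
  rw [← Fintype.card_subtype, ← Nat.card_eq_fintype_card, EC.fiber_card hEC, nsmul_eq_mul]
  push_cast
  ring
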